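/- Let t ↦ μ_t be a weakly continuous curve of probability measures on a bounded domain M ⊆ ℝⁿ. Then there exists a minimizer μ ∈ P₂(ℝⁿ) of μ ↦ ∫₀¹ W₂²(μ, μ_t) dt (a barycenter of the curve), and every such minimizer is supported on the convex hull of M. -/

import Mathlib

open MeasureTheory Set

noncomputable section

/-- `ℝⁿ` with the Euclidean norm. -/
abbrev En (n : ℕ) := EuclideanSpace ℝ (Fin n)

/-- `γ` is a coupling of `μ` and `ν`. -/
def IsCoupling {n : ℕ} (γ : Measure (En n × En n)) (μ ν : Measure (En n)) : Prop :=
  γ.map Prod.fst = μ ∧ γ.map Prod.snd = ν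

/-- The squared quadratic Wasserstein distance `W₂²(μ,ν)`. -/
def W2sq {n : ℕ} (μ ν : Measure (En n)) : ℝ :=
  sInf { c | ∃ γ : Measure (En n × En n), IsCoupling γ μ ν ∧ c = ∫ p, ‖p.1 - p.2‖ ^ 2 ∂γ }

/-- `μ` has finite second moment. -/
def FinSecMom {n : ℕ} (μ : Measure (En n)) : Prop := Integrable (fun x => ‖x‖ ^ 2) μ

/-- The curve `t ↦ μ t` is weakly continuous on `s`. -/
def WeakContOn {n : ℕ} (μ : ℝ → Measure (En n)) (s : Set ℝ) : Prop :=
  ∀ f : BoundedContinuousFunction (En n) ℝ, ContinuousOn (fun t => ∫ x, f x ∂(μ t)) s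

/-- `μb` is a barycenter of the curve `t ↦ μ t`, `t ∈ [0,1]`: it minimizes
`ν ↦ ∫₀¹ W₂²(μ_t, ν) dt` over probability measures with finite second moment. -/
def IsBarycenter {n : ℕ} (μ : ℝ → Measure (En n)) (μb : Measure (En n)) : Prop :=
  IsProbabilityMeasure μb ∧ FinSecMom μb ∧
    ∀ ν : Measure (En n), IsProbabilityMeasure ν → FinSecMom ν →
      ∫ t in Icc (0:ℝ) 1, W2sq (μ t) μb ≤ ∫ t in Icc (0:ℝ) 1, W2sq (μ t) ν

theorem exists_proper_separation {E : Type*} [NormedAddCommGroup E] [NormedSpace ℝ E]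
    [FiniteDimensional ℝ E] {S : Set E} {m : E} (hS : S.Nonempty) (hm : m ∉ convexHull ℝ S) :
    ∃ φ : E →L[ℝ] ℝ, (∀ s ∈ S, φ m ≤ φ s) ∧ ∃ s ∈ S, φ m < φ s := by
  obtain ⟨s₀, hs₀⟩ := hS
  by_cases hA : m ∈ affineSpan ℝ S
  · set V : Submodule ℝ E := (affineSpan ℝ S).direction with hV
    have hVm : ∀ s ∈ S, s - m ∈ V := fun s hs => by
      simpa using AffineSubspace.vsub_mem_direction (subset_affineSpan ℝ S hs) hA
    set S' : Set V := {v | m + (v : E) ∈ S} with hS'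
    have hS'0 : (⟨s₀ - m, hVm s₀ hs₀⟩ : V) ∈ S' := by simpa [hS'] using hs₀
    let g : V →ᵃ[ℝ] E := V.subtype.toAffineMap + AffineMap.const ℝ V m
    have hg : ∀ v, g v = m + (v : E) := fun v => by simp [g, add_comm]
    have hginj : Function.Injective g := fun a b hab => by
      simpa [hg] using hab
    have himg : g '' S' = S := by
      ext x
      constructor
      · rintro ⟨v, hv, rfl⟩
        rw [hg]; exact hv
      · intro hx
        exact ⟨⟨x - m, hVm x hx⟩, by simpa [hS'] using hx, by simp [hg]⟩
    have hspan : affineSpan ℝ S' = ⊤ := by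
      rw [eq_top_iff]
      intro v _
      have h1 : g v ∈ affineSpan ℝ S := by
        rw [hg, add_comm]
        exact AffineSubspace.vadd_mem_of_mem_direction v.2 hA
      rw [← himg, ← AffineSubspace.map_span] at h1
      obtain ⟨w, hw, hwv⟩ := h1
      rw [← hginj hwv]; exact hw
    have h_int := interior_convexHull_nonempty_iff_affineSpan_eq_top.2 hspan
    have h0 : (0 : V) ∉ convexHull ℝ S' := by
      intro h
      apply hm
      rw [← himg, ← AffineMap.image_convexHull]
      exact ⟨0, h, by simp [hg]⟩
    obtain ⟨f, hf0, hf⟩ := geometric_hahn_banach_of_nonempty_interior_point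
      (convex_convexHull ℝ S') (fun h => h0 (interior_subset h)) h_int
    obtain ⟨ψ, hψ⟩ := LinearMap.exists_extend (f : V →ₗ[ℝ] ℝ)
    have hψf : ∀ v : V, ψ v = f v := fun v => by
      simpa using congrArg (fun l => l v) hψ
    have hdiff : ∀ s (hs : s ∈ S), ψ s - ψ m = f ⟨s - m, hVm s hs⟩ := fun s hs => by
      rw [← hψf, ← map_sub]
    refine ⟨-(LinearMap.toContinuousLinearMap ψ), fun s hs => ?_, ?_⟩
    · have h1 := hf ⟨s - m, hVm s hs⟩ (subset_convexHull ℝ S' (by simpa [hS'] using hs))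
      have h2 := hdiff s hs
      simp only [neg_apply, LinearMap.coe_toContinuousLinearMap', map_zero]
        at h1 ⊢
      linarith
    · by_contra! hcon
      apply hf0
      have hz : ∀ v ∈ S', f v = 0 := fun v hv => by
        have h1 := hf v (subset_convexHull ℝ S' hv)
        have h2 := hdiff (m + v) hv
        have h3 := hcon (m + v) hv
        have h4 : (⟨m + v - m, hVm (m + v) hv⟩ : V) = v := by ext; simp
        rw [h4] at h2
        simp only [neg_apply, LinearMap.coe_toContinuousLinearMap', map_zero]
          at h1 h3
        linarith
      have hle : affineSpan ℝ S' ≤ (f : V →ₗ[ℝ] ℝ).ker.toAffineSubspace :=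
        affineSpan_le.2 fun v hv => by simpa using hz v hv
      rw [hspan] at hle
      ext v
      simpa using hle (AffineSubspace.mem_top ℝ V v)
  · have hnot : s₀ - m ∉ (affineSpan ℝ S).direction := fun h => hA <| by
      have h' := AffineSubspace.vadd_mem_of_mem_direction (neg_mem h)
        (subset_affineSpan ℝ S hs₀)
      simpa using h'
    obtain ⟨f, hf, hker⟩ := Submodule.exists_le_ker_of_notMem hnot
    have hconst : ∀ s ∈ S, f s = f s₀ := fun s hs => by
      have : f (s - s₀) = 0 := hker <| by
        simpa using AffineSubspace.vsub_mem_direction (subset_affineSpan ℝ S hs)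
          (subset_affineSpan ℝ S hs₀)
      rw [map_sub] at this
      linarith
    have key : ∀ s ∈ S, f s - f m = f (s₀ - m) := fun s hs => by
      rw [hconst s hs, map_sub]
    refine ⟨f (s₀ - m) • LinearMap.toContinuousLinearMap f, fun s hs => ?_, s₀, hs₀, ?_⟩
    · have h := sub_eq_iff_eq_add'.1 (key s hs)
      simp only [smul_apply, LinearMap.coe_toContinuousLinearMap', smul_eq_mul]
      rw [h, mul_add]
      linarith [mul_self_nonneg (f (s₀ - m))]
    · have h := sub_eq_iff_eq_add'.1 (key s₀ hs₀)
      simp only [smul_apply, LinearMap.coe_toContinuousLinearMap', smul_eq_mul]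
      rw [h, mul_add]
      linarith [mul_self_pos.2 hf]

theorem integral_mem_convexHull_of_dense_in_support {E : Type*} [NormedAddCommGroup E]
    [NormedSpace ℝ E] [FiniteDimensional ℝ E] [MeasurableSpace E] [BorelSpace E]
    {ν : Measure E} [IsProbabilityMeasure ν] (h_int : Integrable (fun y => y) ν) {S : Set E}
    (hS : ∀ U : Set E, IsOpen U → ((∃ s ∈ S, s ∈ U) ↔ 0 < ν U)) :
    ∫ y, y ∂ν ∈ convexHull ℝ S := by
  by_contra hm
  have hne : S.Nonempty := by
    obtain ⟨s, hs, -⟩ := (hS univ isOpen_univ).2 (by simp)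
    exact ⟨s, hs⟩
  obtain ⟨φ, h1, s, hs, h2⟩ := exists_proper_separation hne hm
  set m := ∫ y, y ∂ν
  have hge : ∀ᵐ y ∂ν, φ m ≤ φ y := by
    have hopen : IsOpen {y | φ y < φ m} := isOpen_lt φ.continuous continuous_const
    have h0 : ν {y | φ y < φ m} = 0 := by
      by_contra h
      obtain ⟨s, hs, hs'⟩ := (hS _ hopen).2 (pos_iff_ne_zero.2 h)
      exact absurd (h1 s hs) (not_le.2 hs')
    rw [ae_iff]
    simpa using h0
  have hi : Integrable (fun y => φ y - φ m) ν :=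
    (φ.integrable_comp h_int).sub (integrable_const _)
  have hz : ∫ y, (φ y - φ m) ∂ν = 0 := by
    rw [integral_sub (φ.integrable_comp h_int) (integrable_const _),
      ContinuousLinearMap.integral_comp_comm φ h_int]
    simp [m]
  have heq := (integral_eq_zero_iff_of_nonneg_ae
    (hge.mono fun y hy => by simpa using hy) hi).1 hz
  have hopen : IsOpen {y | φ m < φ y} := isOpen_lt continuous_const φ.continuous
  have hpos := (hS _ hopen).1 ⟨s, hs, h2⟩
  refine hpos.ne' ?_
  rw [← nonpos_iff_eq_zero]
  calc ν {y | φ m < φ y} ≤ ν {y | ¬ (φ y - φ m = 0)} := measure_mono fun y hy => by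
        simp only [mem_ofPred_eq] at hy ⊢
        exact (sub_pos.2 hy).ne'
    _ = 0 := heq

theorem ae_infinitePi_exists_mem_iff {α : Type*} [MeasurableSpace α] (ρ : Measure α)
    [IsProbabilityMeasure ρ] {A : Set α} (hA : MeasurableSet A) :
    ∀ᵐ ω ∂(Measure.infinitePi fun _ : ℕ => ρ), (∃ k, ω k ∈ A) ↔ 0 < ρ A := by
  rcases eq_or_ne (ρ A) 0 with h0 | h0
  · have : ∀ᵐ ω ∂(Measure.infinitePi fun _ : ℕ => ρ), ∀ k, ω k ∉ A := by
      rw [ae_all_iff]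
      intro k
      exact (measurePreserving_eval_infinitePi (fun _ : ℕ => ρ) k).quasiMeasurePreserving.ae
        (measure_eq_zero_iff_ae_notMem.1 h0)
    filter_upwards [this] with ω hω
    simp [h0, hω]
  · have hlt : ρ Aᶜ < 1 := by
      rw [prob_compl_eq_one_sub hA]
      exact ENNReal.sub_lt_self (by simp) (by simp) h0
    have hN : ∀ N : ℕ, Measure.infinitePi (fun _ : ℕ => ρ) {ω | ¬ ∃ k, ω k ∈ A} ≤ ρ Aᶜ ^ N := by
      intro N
      calc _ ≤ Measure.infinitePi (fun _ : ℕ => ρ)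
              ((↑(Finset.range N) : Set ℕ).pi fun _ => Aᶜ) :=
            measure_mono fun ω hω k _ => by
              simp only [not_exists, mem_ofPred_eq] at hω
              exact hω k
        _ = ρ Aᶜ ^ N := by
            rw [Measure.infinitePi_pi _ fun _ _ => hA.compl]
            simp
    have hzero : Measure.infinitePi (fun _ : ℕ => ρ) {ω | ¬ ∃ k, ω k ∈ A} = 0 :=
      le_antisymm (ge_of_tendsto' (ENNReal.tendsto_pow_atTop_nhds_zero_of_lt_one hlt) hN)
        zero_le
    filter_upwards [show ∀ᵐ ω ∂(Measure.infinitePi fun _ : ℕ => ρ), ∃ k, ω k ∈ A from hzero]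
      with ω hω
    simp [hω, pos_iff_ne_zero, h0]

theorem ae_integral_mem_convexHull_range {α β E : Type*} [MeasurableSpace α] [MeasurableSpace β]
    [NormedAddCommGroup E] [NormedSpace ℝ E] [FiniteDimensional ℝ E] [MeasurableSpace E]
    [BorelSpace E] (ρ : Measure α) [IsProbabilityMeasure ρ] (ν : Measure β) [SFinite ν]
    {T : α × β → E} (hT : Measurable T) (h_int : ∀ᵐ x ∂ν, Integrable (fun t => T (t, x)) ρ) :
    ∀ᵐ ω ∂(Measure.infinitePi fun _ : ℕ => ρ), ∀ᵐ x ∂ν,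
      ∫ t, T (t, x) ∂ρ ∈ convexHull ℝ (range fun k => T (ω k, x)) := by
  have := FiniteDimensional.proper_real E
  set B := TopologicalSpace.countableBasis E
  have hBc : B.Countable := TopologicalSpace.countable_countableBasis E
  have hB : TopologicalSpace.IsTopologicalBasis B := TopologicalSpace.isBasis_countableBasis E
  have hgood : ∀ᵐ ω ∂(Measure.infinitePi fun _ : ℕ => ρ), ∀ᵐ x ∂ν,
      ∀ U ∈ B, (∃ k, T (ω k, x) ∈ U) ↔ 0 < ρ {t | T (t, x) ∈ U} := by
    simp only [ae_ball_iff hBc]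
    intro U hU
    have hUm : MeasurableSet U := (hB.isOpen hU).measurableSet
    have hpre : MeasurableSet (T ⁻¹' U) := hT hUm
    refine (Measure.ae_ae_comm ?_).1 (Filter.Eventually.of_forall fun x =>
      ae_infinitePi_exists_mem_iff ρ
        (A := {t | T (t, x) ∈ U}) (measurable_prodMk_right hpre))
    have h1 : MeasurableSet {p : β × (ℕ → α) | ∃ k, T (p.2 k, p.1) ∈ U} := by
      have : {p : β × (ℕ → α) | ∃ k, T (p.2 k, p.1) ∈ U}
          = ⋃ k, (fun p : β × (ℕ → α) => (p.2 k, p.1)) ⁻¹' (T ⁻¹' U) := by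
        ext; simp
      rw [this]
      exact MeasurableSet.iUnion fun k =>
        ((measurable_pi_apply k).comp measurable_snd |>.prodMk measurable_fst) hpre
    have h2 : MeasurableSet {p : β × (ℕ → α) | 0 < ρ {t | T (t, p.1) ∈ U}} :=
      measurableSet_lt measurable_const
        ((measurable_measure_prodMk_right hpre).comp measurable_fst)
    exact h1.iff h2
  filter_upwards [hgood] with ω hω
  filter_upwards [hω, h_int] with x hx hxint
  have hTx : Measurable fun t => T (t, x) := hT.comp measurable_prodMk_right
  have : IsProbabilityMeasure (ρ.map fun t => T (t, x)) :=
    Measure.isProbabilityMeasure_map hTx.aemeasurable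
  have key := integral_mem_convexHull_of_dense_in_support (ν := ρ.map fun t => T (t, x))
    (S := range fun k => T (ω k, x))
    ((integrable_map_measure measurable_id.aestronglyMeasurable hTx.aemeasurable).2 hxint) ?_
  · rwa [integral_map (f := fun y => y) hTx.aemeasurable
      measurable_id.aestronglyMeasurable] at key
  intro U hU
  rw [Measure.map_apply hTx hU.measurableSet]
  constructor
  · rintro ⟨_, ⟨k, rfl⟩, hk⟩
    obtain ⟨V, hV, hkV, hVU⟩ := hB.exists_subset_of_mem_open hk hU
    exact ((hx V hV).1 ⟨k, hkV⟩).trans_le (measure_mono fun t ht => hVU ht)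
  · intro hpos
    by_contra! hcon
    refine hpos.ne' ?_
    obtain ⟨s, hsB, rfl⟩ := hB.open_eq_sUnion hU
    rw [preimage_sUnion, measure_biUnion_null_iff (hBc.mono hsB)]
    intro V hV
    by_contra h
    obtain ⟨k, hk⟩ := (hx V (hsB hV)).2 (pos_iff_ne_zero.2 h)
    exact hcon _ ⟨k, rfl⟩ ⟨V, hV, hk⟩

theorem Convex.integral_mem_of_finiteDimensional {α E : Type*} [MeasurableSpace α]
    [NormedAddCommGroup E] [NormedSpace ℝ E] [FiniteDimensional ℝ E] [MeasurableSpace E]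
    [BorelSpace E] {ρ : Measure α} [IsProbabilityMeasure ρ] {C : Set E} (hC : Convex ℝ C)
    {f : α → E} (hfm : Measurable f) (hf : Integrable f ρ) (hfC : ∀ᵐ t ∂ρ, f t ∈ C) :
    ∫ t, f t ∂ρ ∈ C := by
  have h1 := ae_integral_mem_convexHull_range ρ (Measure.dirac ()) (T := fun p => f p.1)
    (hfm.comp measurable_fst) (by simpa using hf)
  have h2 : ∀ᵐ ω ∂(Measure.infinitePi fun _ : ℕ => ρ), ∀ k, f (ω k) ∈ C :=
    ae_all_iff.2 fun k =>
      (measurePreserving_eval_infinitePi (fun _ : ℕ => ρ) k).quasiMeasurePreserving.ae hfC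
  obtain ⟨ω, h1, h2⟩ := (h1.and h2).exists
  have h1 := (ae_dirac_eq (a := ()) ▸ h1 : ∀ᶠ x in pure (), _)
  exact convexHull_min (range_subset_iff.2 h2) hC (by simpa using h1)

open ProbabilityTheory
open scoped Topology

/-- The quadratic cost, with values in `[0, ∞]`. -/
def sqCost {n : ℕ} (p : En n × En n) : ENNReal := ENNReal.ofReal (‖p.1 - p.2‖ ^ 2)

/-- The squared Wasserstein distance, with values in `[0, ∞]`. -/
def transportCost {n : ℕ} (μ ν : Measure (En n)) : ENNReal :=
  ⨅ (γ : Measure (En n × En n)) (_ : IsCoupling γ μ ν), ∫⁻ p, sqCost p ∂γ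

section Wasserstein

variable {n : ℕ}

theorem continuous_sqCost : Continuous (sqCost (n := n)) := by
  exact ENNReal.continuous_ofReal.comp (by fun_prop)

theorem measurable_sqCost : Measurable (sqCost (n := n)) := continuous_sqCost.measurable

theorem sq_norm_sub_le (x y : En n) : ‖x - y‖ ^ 2 ≤ 2 * ‖x‖ ^ 2 + 2 * ‖y‖ ^ 2 := by
  have h := pow_le_pow_left₀ (norm_nonneg _) (norm_sub_le x y) 2
  nlinarith [sq_nonneg (‖x‖ - ‖y‖)]

theorem IsCoupling.isProbabilityMeasure {γ : Measure (En n × En n)} {μ ν : Measure (En n)}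
    [IsProbabilityMeasure μ] (h : IsCoupling γ μ ν) : IsProbabilityMeasure γ :=
  have : IsProbabilityMeasure (γ.map Prod.fst) := h.1 ▸ inferInstance
  Measure.isProbabilityMeasure_of_map Prod.fst

theorem isCoupling_prod (μ ν : Measure (En n)) [IsProbabilityMeasure μ]
    [IsProbabilityMeasure ν] : IsCoupling (μ.prod ν) μ ν := by
  constructor <;> simp [Measure.map_fst_prod, Measure.map_snd_prod]

theorem IsCoupling.integrable {γ : Measure (En n × En n)} {μ ν : Measure (En n)}
    (h : IsCoupling γ μ ν) (hμ : FinSecMom μ) (hν : FinSecMom ν) :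
    Integrable (fun p => 2 * ‖p.1‖ ^ 2 + 2 * ‖p.2‖ ^ 2) γ := by
  unfold FinSecMom at hμ hν
  rw [← h.1] at hμ
  rw [← h.2] at hν
  exact ((hμ.comp_measurable measurable_fst).const_mul 2).add
    ((hν.comp_measurable measurable_snd).const_mul 2)

theorem IsCoupling.integrable_sq_dist {γ : Measure (En n × En n)} {μ ν : Measure (En n)}
    (h : IsCoupling γ μ ν) (hμ : FinSecMom μ) (hν : FinSecMom ν) :
    Integrable (fun p => ‖p.1 - p.2‖ ^ 2) γ :=
  (h.integrable hμ hν).mono' (by fun_prop) (Filter.Eventually.of_forall fun p => by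
    simpa using sq_norm_sub_le p.1 p.2)

theorem IsCoupling.lintegral_sqCost {γ : Measure (En n × En n)} {μ ν : Measure (En n)}
    (h : IsCoupling γ μ ν) (hμ : FinSecMom μ) (hν : FinSecMom ν) :
    ∫⁻ p, sqCost p ∂γ = ENNReal.ofReal (∫ p, ‖p.1 - p.2‖ ^ 2 ∂γ) :=
  (ofReal_integral_eq_lintegral_ofReal (h.integrable_sq_dist hμ hν)
    (Filter.Eventually.of_forall fun p => by positivity)).symm

theorem transportCost_le {μ ν : Measure (En n)} [IsProbabilityMeasure μ]
    [IsProbabilityMeasure ν] (hμ : FinSecMom μ) (hν : FinSecMom ν) :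
    transportCost μ ν ≤ ENNReal.ofReal (2 * (∫ x, ‖x‖ ^ 2 ∂μ) + 2 * ∫ x, ‖x‖ ^ 2 ∂ν) := by
  have h := isCoupling_prod μ ν
  refine (iInf₂_le (f := fun γ (_ : IsCoupling γ μ ν) => ∫⁻ p, sqCost p ∂γ) _ h).trans ?_
  rw [h.lintegral_sqCost hμ hν]
  refine ENNReal.ofReal_le_ofReal ?_
  calc _ ≤ ∫ p, (2 * ‖p.1‖ ^ 2 + 2 * ‖p.2‖ ^ 2) ∂(μ.prod ν) :=
        integral_mono (h.integrable_sq_dist hμ hν) (h.integrable hμ hν) fun p =>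
          sq_norm_sub_le p.1 p.2
    _ = _ := by
        have h1 : Integrable (fun p : En n × En n => ‖p.1‖ ^ 2) (μ.prod ν) := hμ.comp_fst ν
        have h2 : Integrable (fun p : En n × En n => ‖p.2‖ ^ 2) (μ.prod ν) := hν.comp_snd μ
        rw [integral_add (h1.const_mul 2) (h2.const_mul 2), integral_const_mul,
          integral_const_mul, integral_fun_fst (fun x : En n => ‖x‖ ^ 2),
          integral_fun_snd (fun x : En n => ‖x‖ ^ 2)]
        simp

theorem ofReal_W2sq {μ ν : Measure (En n)} [IsProbabilityMeasure μ]
    [IsProbabilityMeasure ν] (hμ : FinSecMom μ) (hν : FinSecMom ν) :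
    ENNReal.ofReal (W2sq μ ν) = transportCost μ ν := by
  have htop : transportCost μ ν ≠ ⊤ :=
    ((transportCost_le hμ hν).trans_lt ENNReal.ofReal_lt_top).ne
  have hbdd : BddBelow { c | ∃ γ : Measure (En n × En n), IsCoupling γ μ ν ∧
      c = ∫ p, ‖p.1 - p.2‖ ^ 2 ∂γ } := by
    refine ⟨0, ?_⟩
    rintro _ ⟨γ, -, rfl⟩
    exact integral_nonneg fun p => by positivity
  apply le_antisymm
  · refine le_iInf₂ fun γ hγ => ?_
    rw [hγ.lintegral_sqCost hμ hν]
    exact ENNReal.ofReal_le_ofReal (csInf_le hbdd ⟨γ, hγ, rfl⟩)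
  · rw [← ENNReal.ofReal_toReal htop]
    refine ENNReal.ofReal_le_ofReal (le_csInf ⟨_, _, isCoupling_prod μ ν, rfl⟩ ?_)
    rintro _ ⟨γ, hγ, rfl⟩
    refine ENNReal.toReal_le_of_le_ofReal (integral_nonneg fun p => by positivity) ?_
    rw [← hγ.lintegral_sqCost hμ hν]
    exact iInf₂_le (f := fun γ (_ : IsCoupling γ μ ν) => ∫⁻ p, sqCost p ∂γ) _ hγ

theorem W2sq_nonneg (μ ν : Measure (En n)) : 0 ≤ W2sq μ ν := by
  refine Real.sInf_nonneg ?_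
  rintro _ ⟨γ, -, rfl⟩
  exact integral_nonneg fun p => by positivity

theorem exists_isCoupling_lintegral_le (μ ν : Measure (En n)) {ε : ENNReal} (hε : ε ≠ 0)
    [IsProbabilityMeasure μ] [IsProbabilityMeasure ν] :
    ∃ γ, IsCoupling γ μ ν ∧ ∫⁻ p, sqCost p ∂γ ≤ transportCost μ ν + ε := by
  by_cases htop : transportCost μ ν = ⊤
  · exact ⟨_, isCoupling_prod μ ν, by simp [htop]⟩
  · have hlt : transportCost μ ν < transportCost μ ν + ε := ENNReal.lt_add_right htop hε
    conv_lhs at hlt => unfold transportCost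
    simp only [iInf_lt_iff] at hlt
    obtain ⟨γ, hγ, h⟩ := hlt
    exact ⟨γ, hγ, h.le⟩

end Wasserstein

theorem ProbabilityMeasure.exists_subseq_tendsto_of_tight {Z : Type*} [TopologicalSpace Z]
    [PolishSpace Z] [MeasurableSpace Z] [BorelSpace Z] {P : ℕ → ProbabilityMeasure Z}
    (htight : ∀ ε : ENNReal, 0 < ε → ∃ K : Set Z, IsCompact K ∧ ∀ k, (P k : Measure Z) Kᶜ ≤ ε) :
    ∃ (Q : ProbabilityMeasure Z) (φ : ℕ → ℕ), StrictMono φ ∧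
      Filter.Tendsto (P ∘ φ) Filter.atTop (𝓝 Q) := by
  have hcomp := isCompact_closure_of_isTightMeasureSet (S := range P) <|
    isTightMeasureSet_iff_exists_isCompact_measure_compl_le.2 fun ε hε => by
      obtain ⟨K, hK, h⟩ := htight ε hε
      refine ⟨K, hK, ?_⟩
      rintro _ ⟨_, ⟨k, rfl⟩, rfl⟩
      exact h k
  obtain ⟨Q, -, φ, hφ, hQ⟩ := hcomp.tendsto_subseq fun k => subset_closure ⟨k, rfl⟩
  exact ⟨Q, φ, hφ, hQ⟩

theorem ProbabilityMeasure.lintegral_le_of_tendsto {Z : Type*} [TopologicalSpace Z]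
    [PolishSpace Z] [MeasurableSpace Z] [BorelSpace Z] {P : ℕ → ProbabilityMeasure Z}
    {Q : ProbabilityMeasure Z} (hPQ : Filter.Tendsto P Filter.atTop (𝓝 Q)) {c : Z → ℝ}
    (hc : Continuous c) (hc0 : 0 ≤ c) {a : ENNReal} {ε : ℕ → ENNReal}
    (hε : Filter.Tendsto ε Filter.atTop (𝓝 0))
    (h : ∀ k, ∫⁻ z, ENNReal.ofReal (c z) ∂(P k : Measure Z) ≤ a + ε k) :
    ∫⁻ z, ENNReal.ofReal (c z) ∂(Q : Measure Z) ≤ a := by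
  let _ := TopologicalSpace.upgradeIsCompletelyMetrizable Z
  calc _ ≤ Filter.liminf (fun k => ∫⁻ z, ENNReal.ofReal (c z) ∂(P k : Measure Z)) Filter.atTop :=
        lintegral_le_liminf_lintegral_of_forall_isOpen_measure_le_liminf_measure hc hc0
          fun G hG => ProbabilityMeasure.le_liminf_measure_open_of_tendsto hPQ hG
    _ ≤ Filter.liminf (fun k => a + ε k) Filter.atTop :=
        Filter.liminf_le_liminf (Filter.Eventually.of_forall h)
    _ = a := by
        have : Filter.Tendsto (fun k => a + ε k) Filter.atTop (𝓝 (a + 0)) :=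
          tendsto_const_nhds.add hε
        rw [this.liminf_eq, add_zero]

theorem measurable_probabilityMeasure_of_continuous {T X : Type*} [TopologicalSpace T]
    [MeasurableSpace T] [BorelSpace T] [TopologicalSpace.PseudoMetrizableSpace T]
    [TopologicalSpace X] [PolishSpace X]
    [MeasurableSpace X] [BorelSpace X] {m : T → ProbabilityMeasure X} (hm : Continuous m) :
    Measurable fun t => (m t : Measure X) := by
  let _ := TopologicalSpace.upgradeIsCompletelyMetrizable X
  refine Measurable.measure_of_isPiSystem_of_isProbabilityMeasure
    (S := {s : Set X | IsOpen s}) (BorelSpace.measurable_eq) isPiSystem_isOpen fun s hs => ?_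
  refine LowerSemicontinuous.measurable ?_
  rw [lowerSemicontinuous_iff_le_liminf]
  intro t
  exact ProbabilityMeasure.le_liminf_measure_open_of_tendsto (hm.tendsto t) hs

section Curve

variable {n : ℕ}

theorem exists_isCompact_measure_compl_le {X : Type*} [TopologicalSpace X] [PolishSpace X]
    [MeasurableSpace X] [BorelSpace X] (ν : Measure X) [IsProbabilityMeasure ν] {ε : ENNReal}
    (hε : 0 < ε) : ∃ K : Set X, IsCompact K ∧ ν Kᶜ ≤ ε := by
  obtain ⟨K, hK, h⟩ := isTightMeasureSet_iff_exists_isCompact_measure_compl_le.1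
    (isTightMeasureSet_singleton (μ := ν)) ε hε
  exact ⟨K, hK, h ν rfl⟩

theorem measure_compl_prod_le {α β : Type*} [MeasurableSpace α] [MeasurableSpace β]
    (γ : Measure (α × β)) {A : Set α} {B : Set β} (hA : MeasurableSet A)
    (hB : MeasurableSet B) :
    γ (A ×ˢ B)ᶜ ≤ γ.map Prod.fst Aᶜ + γ.map Prod.snd Bᶜ := by
  rw [Measure.map_apply measurable_fst hA.compl, Measure.map_apply measurable_snd hB.compl]
  refine (measure_mono ?_).trans (measure_union_le _ _)
  rintro ⟨a, b⟩ h
  simp only [mem_compl_iff, mem_prod, not_and_or] at h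
  exact h

theorem lowerSemicontinuous_transportCost {T : Type*} [TopologicalSpace T] [SequentialSpace T]
    {m : T → ProbabilityMeasure (En n)} (hm : Continuous m) {R : ℝ}
    (hR : ∀ t, (m t : Measure (En n)) (Metric.closedBall 0 R)ᶜ = 0) (ν : Measure (En n))
    [IsProbabilityMeasure ν] :
    LowerSemicontinuous fun t => transportCost (m t : Measure (En n)) ν := by
  rw [lowerSemicontinuous_iff_isClosed_preimage]
  refine fun a => IsSeqClosed.isClosed fun u t hu hut => ?_
  have hε : ∀ k : ℕ, ((k : ENNReal) + 1)⁻¹ ≠ 0 := fun k => by simp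
  choose γ hγ hcost using fun k : ℕ =>
    exists_isCoupling_lintegral_le (m (u k) : Measure (En n)) ν (hε k)
  have hprob : ∀ k, IsProbabilityMeasure (γ k) := fun k => (hγ k).isProbabilityMeasure
  let P : ℕ → ProbabilityMeasure (En n × En n) := fun k => ⟨γ k, hprob k⟩
  obtain ⟨Q, φ, hφ, hQ⟩ := ProbabilityMeasure.exists_subseq_tendsto_of_tight (P := P) <| by
    intro ε hε
    obtain ⟨K, hK, hKε⟩ := exists_isCompact_measure_compl_le ν hε
    refine ⟨Metric.closedBall 0 R ×ˢ K, (isCompact_closedBall 0 R).prod hK, fun k => ?_⟩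
    refine (measure_compl_prod_le (γ k) measurableSet_closedBall hK.measurableSet).trans ?_
    rw [(hγ k).1, (hγ k).2, hR, zero_add]
    exact hKε
  have hcoup : IsCoupling (Q : Measure (En n × En n)) (m t) ν := by
    constructor
    · have h1 := ProbabilityMeasure.tendsto_map_of_tendsto_of_continuous _ _ hQ continuous_fst
      have h2 : Filter.Tendsto (fun k => m (u (φ k))) Filter.atTop (𝓝 (m t)) :=
        (hm.tendsto t).comp (hut.comp hφ.tendsto_atTop)
      have e : ∀ k, (P (φ k)).map continuous_fst.measurable.aemeasurable = m (u (φ k)) :=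
        fun k => Subtype.ext (hγ (φ k)).1
      have h3 := tendsto_nhds_unique (h1.congr e) h2
      exact congrArg Subtype.val h3
    · have h1 := ProbabilityMeasure.tendsto_map_of_tendsto_of_continuous _ _ hQ continuous_snd
      let ν' : ProbabilityMeasure (En n) := ⟨ν, inferInstance⟩
      have e : ∀ k, (P (φ k)).map continuous_snd.measurable.aemeasurable = ν' :=
        fun k => Subtype.ext (hγ (φ k)).2
      have h3 := tendsto_nhds_unique (h1.congr e) tendsto_const_nhds
      exact congrArg Subtype.val h3
  have hlim : Filter.Tendsto (fun k : ℕ => ((φ k : ENNReal) + 1)⁻¹) Filter.atTop (𝓝 0) := by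
    have : Filter.Tendsto (fun k : ℕ => ((k : ENNReal) + 1)⁻¹) Filter.atTop (𝓝 0) := by
      refine (ENNReal.tendsto_inv_nat_nhds_zero.comp (Filter.tendsto_add_atTop_nat 1)).congr
        fun k => by simp
    exact this.comp hφ.tendsto_atTop
  refine (iInf₂_le (f := fun γ (_ : IsCoupling γ (m t : Measure (En n)) ν) =>
    ∫⁻ p, sqCost p ∂γ) _ hcoup).trans ?_
  refine ProbabilityMeasure.lintegral_le_of_tendsto hQ (c := fun p => ‖p.1 - p.2‖ ^ 2)
    (by fun_prop) (fun p => by positivity) hlim fun k => ?_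
  exact (hcost (φ k)).trans (add_le_add_left (hu (φ k)) _)

/-- The lower-sum representatives: on each fibre of `ι`, a point where `g` is at most its mean. -/
theorem exists_lintegral_comp_le {T : Type*} [MeasurableSpace T] [Nonempty T] (ρ : Measure T)
    [IsProbabilityMeasure ρ] {g : T → ENNReal} (hg : Measurable g) {ι : T → ℕ}
    (hι : Measurable ι) :
    ∃ σ : ℕ → T, (∀ t, ι (σ (ι t)) = ι t) ∧ ∫⁻ t, g (σ (ι t)) ∂ρ ≤ ∫⁻ t, g t ∂ρ := by
  have hfib : ∀ i, MeasurableSet (ι ⁻¹' {i}) := fun i => hι (measurableSet_singleton i)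
  have hex : ∀ i, ∃ s : T, (∀ t, ι t = i → ι s = i) ∧
      g s * ρ (ι ⁻¹' {i}) ≤ ∫⁻ t in ι ⁻¹' {i}, g t ∂ρ := by
    intro i
    by_cases h0 : ρ (ι ⁻¹' {i}) = 0
    · by_cases hne : ∃ s, ι s = i
      · obtain ⟨s, hs⟩ := hne
        exact ⟨s, fun _ _ => hs, by simp [h0]⟩
      · exact ⟨Classical.arbitrary T, fun t ht => absurd ⟨t, ht⟩ hne, by simp [h0]⟩
    · obtain ⟨s, hs, hle⟩ := exists_le_setLAverage h0 (measure_ne_top ρ _)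
        hg.aemeasurable.restrict
      refine ⟨s, fun _ _ => hs, ?_⟩
      rw [setLAverage_eq, ENNReal.le_div_iff_mul_le (Or.inl h0)
        (Or.inl (measure_ne_top ρ _))] at hle
      exact hle
  choose σ hσ hσg using hex
  refine ⟨σ, fun t => hσ _ t rfl, ?_⟩
  have hU : (⋃ i, ι ⁻¹' {i}) = univ := by
    ext t; simp
  have hd : Pairwise (Function.onFun Disjoint fun i => ι ⁻¹' {i}) := fun i j hij =>
    Disjoint.preimage _ (by simpa using hij)
  rw [← setLIntegral_univ, ← hU, lintegral_iUnion hfib hd, ← setLIntegral_univ (f := g), ← hU,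
    lintegral_iUnion hfib hd]
  refine ENNReal.tsum_le_tsum fun i => ?_
  rw [setLIntegral_congr_fun (g := fun _ => g (σ i)) (hfib i) (fun t ht => by
    rw [show ι t = i from ht]), setLIntegral_const]
  exact hσg i

end Curve

section Plan

variable {n : ℕ}

/-- `P` is a transport plan, over the unit time interval, between the family `κ` and `ν`. -/
structure IsPlan (κ : Kernel unitInterval (En n)) (P : Measure (unitInterval × En n × En n))
    (ν : Measure (En n)) : Prop where
  curve : P.map (fun p => (p.1, p.2.1)) = (volume : Measure unitInterval) ⊗ₘ κ
  marg : P.map (fun p => (p.1, p.2.2)) = (volume : Measure unitInterval).prod ν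

theorem IsPlan.isProbabilityMeasure {κ : Kernel unitInterval (En n)} [IsMarkovKernel κ]
    {P : Measure (unitInterval × En n × En n)} {ν : Measure (En n)} (h : IsPlan κ P ν) :
    IsProbabilityMeasure P :=
  have : IsProbabilityMeasure (P.map fun p => (p.1, p.2.1)) := h.curve ▸ inferInstance
  Measure.isProbabilityMeasure_of_map fun p => (p.1, p.2.1)

theorem IsPlan.map_fst {κ : Kernel unitInterval (En n)} [IsMarkovKernel κ]
    {P : Measure (unitInterval × En n × En n)} {ν : Measure (En n)} (h : IsPlan κ P ν) :
    P.fst = volume := by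
  have h1 := congrArg Measure.fst h.curve
  rw [Measure.fst_compProd] at h1
  rw [← h1, Measure.fst, Measure.fst, Measure.map_map measurable_fst (by fun_prop)]
  rfl

theorem map_compProd_fst {η : Kernel unitInterval (En n × En n)} [IsSFiniteKernel η] :
    ((volume : Measure unitInterval) ⊗ₘ η).map (fun p => (p.1, p.2.1)) =
      volume ⊗ₘ (η.map Prod.fst) := by
  rw [Measure.compProd_map measurable_fst]
  rfl

theorem map_compProd_snd {η : Kernel unitInterval (En n × En n)} [IsSFiniteKernel η] :
    ((volume : Measure unitInterval) ⊗ₘ η).map (fun p => (p.1, p.2.2)) =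
      volume ⊗ₘ (η.map Prod.snd) := by
  rw [Measure.compProd_map measurable_snd]
  rfl

theorem IsPlan.lintegral_transportCost_le {κ : Kernel unitInterval (En n)} [IsMarkovKernel κ]
    {P : Measure (unitInterval × En n × En n)} {ν : Measure (En n)} [IsProbabilityMeasure ν]
    (h : IsPlan κ P ν) :
    ∫⁻ t : unitInterval, transportCost (κ t) ν ≤ ∫⁻ p, sqCost p.2 ∂P := by
  have := h.isProbabilityMeasure
  have hP : (volume : Measure unitInterval) ⊗ₘ P.condKernel = P := by
    rw [← h.map_fst, P.disintegrate P.condKernel]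
  have h1 : P.condKernel.map Prod.fst =ᵐ[volume] κ := by
    refine Kernel.ae_eq_of_compProd_eq ?_
    rw [← map_compProd_fst, hP, h.curve]
  have h2 : P.condKernel.map Prod.snd =ᵐ[volume] Kernel.const unitInterval ν := by
    refine Kernel.ae_eq_of_compProd_eq ?_
    rw [← map_compProd_snd, hP, h.marg, Measure.compProd_const]
  conv_rhs => rw [← hP]
  rw [Measure.lintegral_compProd (f := fun p => sqCost p.2)
    (measurable_sqCost.comp measurable_snd)]
  refine lintegral_mono_ae ?_
  filter_upwards [h1, h2] with t ht1 ht2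
  rw [Kernel.map_apply _ measurable_fst] at ht1
  rw [Kernel.map_apply _ measurable_snd, Kernel.const_apply] at ht2
  exact iInf₂_le (f := fun γ (_ : IsCoupling γ (κ t) ν) => ∫⁻ p, sqCost p ∂γ) _ ⟨ht1, ht2⟩

/-- The Markov kernel of a continuous curve of probability measures. -/
def curveKernel (m : unitInterval → ProbabilityMeasure (En n)) (hm : Continuous m) :
    Kernel unitInterval (En n) :=
  ⟨fun t => m t, measurable_probabilityMeasure_of_continuous hm⟩

instance isMarkovKernel_curveKernel (m : unitInterval → ProbabilityMeasure (En n))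
    (hm : Continuous m) : IsMarkovKernel (curveKernel m hm) :=
  ⟨fun t => inferInstanceAs (IsProbabilityMeasure (m t : Measure (En n)))⟩

/-- A probability measure, bundled. -/
def bundleProbability {Z : Type*} [MeasurableSpace Z] (P : Measure Z)
    [IsProbabilityMeasure P] : ProbabilityMeasure Z := ⟨P, inferInstance⟩

theorem coe_bundleProbability {Z : Type*} [MeasurableSpace Z] (P : Measure Z)
    [IsProbabilityMeasure P] : (bundleProbability P : Measure Z) = P := rfl

theorem map_eq_of_tendsto {Z Y : Type*} [TopologicalSpace Z] [MeasurableSpace Z]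
    [OpensMeasurableSpace Z] [TopologicalSpace Y] [HasOuterApproxClosed Y] [MeasurableSpace Y]
    [BorelSpace Y] {P : ℕ → ProbabilityMeasure Z} {Q : ProbabilityMeasure Z}
    (hPQ : Filter.Tendsto P Filter.atTop (𝓝 Q)) {c : Z → Y} (hc : Continuous c)
    {N : ℕ → ProbabilityMeasure Y} {N' : ProbabilityMeasure Y}
    (hN : Filter.Tendsto N Filter.atTop (𝓝 N'))
    (h : ∀ k, (P k : Measure Z).map c = N k) : (Q : Measure Z).map c = N' := by
  have h1 := ProbabilityMeasure.tendsto_map_of_tendsto_of_continuous _ _ hPQ hc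
  have e : ∀ k, (P k).map hc.measurable.aemeasurable = N k := fun k => Subtype.ext (h k)
  have h2 := tendsto_nhds_unique (h1.congr e) hN
  exact congrArg Subtype.val h2

theorem tendsto_compProd_curveKernel_comap {m : unitInterval → ProbabilityMeasure (En n)}
    (hm : Continuous m) {s : ℕ → unitInterval → unitInterval} (hs : ∀ k, Measurable (s k))
    (hst : ∀ t, Filter.Tendsto (fun k => s k t) Filter.atTop (𝓝 t)) :
    Filter.Tendsto
      (fun k => bundleProbability (volume ⊗ₘ ((curveKernel m hm).comap (s k) (hs k))))
      Filter.atTop (𝓝 (bundleProbability (volume ⊗ₘ (curveKernel m hm)))) := by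
  rw [ProbabilityMeasure.tendsto_iff_forall_integral_tendsto]
  intro f
  have h_int : ∀ (η : Kernel unitInterval (En n)) [IsMarkovKernel η],
      ∫ p, f p ∂((volume : Measure unitInterval) ⊗ₘ η) =
        ∫ t : unitInterval, ∫ x, f (t, x) ∂(η t) := fun η _ =>
    Measure.integral_compProd (f.integrable _)
  simp only [coe_bundleProbability]
  rw [h_int]
  simp_rw [h_int]
  refine tendsto_integral_of_dominated_convergence (fun _ => ‖f‖) (fun k => ?_)
    (integrable_const _) (fun k => ?_) (Filter.Eventually.of_forall fun t => ?_)
  · exact (StronglyMeasurable.integral_kernel_prod_right'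
      f.continuous.measurable.stronglyMeasurable).aestronglyMeasurable
  · refine Filter.Eventually.of_forall fun t => ?_
    exact (f.compContinuous ⟨fun x => (t, x), by fun_prop⟩).norm_integral_le_norm _ |>.trans
      (BoundedContinuousFunction.norm_compContinuous_le f _)
  · have h1 : Filter.Tendsto (fun k => m (s k t)) Filter.atTop (𝓝 (m t)) :=
      (hm.tendsto t).comp (hst t)
    exact ProbabilityMeasure.tendsto_iff_forall_integral_tendsto.1 h1
      (f.compContinuous ⟨fun x => (t, x), by fun_prop⟩)

theorem IsPlan.measure_compl_le {κ : Kernel unitInterval (En n)} [IsMarkovKernel κ]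
    {P : Measure (unitInterval × En n × En n)} {ν : Measure (En n)}
    [IsProbabilityMeasure ν] (h : IsPlan κ P ν) {A K : Set (En n)} (hA : MeasurableSet A)
    (hK : MeasurableSet K) (hκ : ∀ t, κ t Aᶜ = 0) :
    P (univ ×ˢ (A ×ˢ K))ᶜ ≤ ν Kᶜ := by
  have h1 : P ((fun p => (p.1, p.2.1)) ⁻¹' (univ ×ˢ Aᶜ)) = 0 := by
    rw [← Measure.map_apply (by fun_prop) (MeasurableSet.univ.prod hA.compl), h.curve,
      Measure.compProd_apply_prod MeasurableSet.univ hA.compl]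
    simp [hκ]
  have h2 : P ((fun p => (p.1, p.2.2)) ⁻¹' (univ ×ˢ Kᶜ)) = ν Kᶜ := by
    rw [← Measure.map_apply (by fun_prop) (MeasurableSet.univ.prod hK.compl), h.marg,
      Measure.prod_prod]
    simp
  calc _ ≤ P ((fun p => (p.1, p.2.1)) ⁻¹' (univ ×ˢ Aᶜ) ∪
          (fun p => (p.1, p.2.2)) ⁻¹' (univ ×ˢ Kᶜ)) := measure_mono fun p hp => by
        simp only [mem_compl_iff, mem_prod, mem_univ, true_and, not_and_or] at hp
        simpa using hp
    _ ≤ _ := (measure_union_le _ _).trans (by rw [h1, h2, zero_add])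

end Plan

section PlanExistence

variable {n : ℕ}

theorem tendsto_inv_add_one_nhds_zero :
    Filter.Tendsto (fun k : ℕ => ((k : ENNReal) + 1)⁻¹) Filter.atTop (𝓝 0) :=
  (ENNReal.tendsto_inv_nat_nhds_zero.comp (Filter.tendsto_add_atTop_nat 1)).congr
    fun k => by simp

/-- The index of the cell of the uniform partition of mesh `1 / (k + 1)` containing `t`. -/
def cellIndex (k : ℕ) (t : unitInterval) : ℕ := ⌊((k : ℝ) + 1) * t⌋₊

theorem measurable_cellIndex (k : ℕ) : Measurable (cellIndex k) :=
  Nat.measurable_floor.comp (by fun_prop)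

theorem dist_le_of_cellIndex_eq {k : ℕ} {s t : unitInterval} (h : cellIndex k s = cellIndex k t) :
    dist s t ≤ 1 / ((k : ℝ) + 1) := by
  have hk : (0 : ℝ) < (k : ℝ) + 1 := by positivity
  have hs := Nat.floor_le (mul_nonneg hk.le s.2.1)
  have ht := Nat.floor_le (mul_nonneg hk.le t.2.1)
  have hs' := Nat.lt_floor_add_one (((k : ℝ) + 1) * s)
  have ht' := Nat.lt_floor_add_one (((k : ℝ) + 1) * t)
  unfold cellIndex at h
  rw [h] at hs hs'
  rw [Subtype.dist_eq, Real.dist_eq, le_div_iff₀ hk]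
  conv_lhs => rw [← abs_of_pos hk]
  rw [← abs_mul, abs_le]
  constructor <;> nlinarith

theorem exists_approx_plan {m : unitInterval → ProbabilityMeasure (En n)} (hm : Continuous m)
    {R : ℝ} (hR : ∀ t, (m t : Measure (En n)) (Metric.closedBall 0 R)ᶜ = 0) (ν : Measure (En n))
    [IsProbabilityMeasure ν] (k : ℕ) :
    ∃ (P : Measure (unitInterval × En n × En n)) (s : unitInterval → unitInterval)
      (hs : Measurable s), (∀ t, dist (s t) t ≤ 1 / ((k : ℝ) + 1)) ∧
      IsPlan ((curveKernel m hm).comap s hs) P ν ∧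
      ∫⁻ p, sqCost p.2 ∂P ≤
        (∫⁻ t, transportCost (m t : Measure (En n)) ν) + ((k : ENNReal) + 1)⁻¹ := by
  have hlsc := lowerSemicontinuous_transportCost hm hR ν
  obtain ⟨τ, hτ, hτg⟩ := exists_lintegral_comp_le (volume : Measure unitInterval)
    hlsc.measurable (measurable_cellIndex k)
  have hε : ((k : ENNReal) + 1)⁻¹ ≠ 0 := by simp
  choose γ hγ hcost using fun i : ℕ =>
    exists_isCoupling_lintegral_le (m (τ i) : Measure (En n)) ν hε
  have hprob : ∀ i, IsProbabilityMeasure (γ i) := fun i => (hγ i).isProbabilityMeasure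
  have hτm : Measurable fun t => τ (cellIndex k t) :=
    (measurable_of_countable τ).comp (measurable_cellIndex k)
  let η : Kernel unitInterval (En n × En n) :=
    ⟨fun t => γ (cellIndex k t), (measurable_of_countable γ).comp (measurable_cellIndex k)⟩
  have hη : IsMarkovKernel η := ⟨fun t => hprob _⟩
  refine ⟨volume ⊗ₘ η, fun t => τ (cellIndex k t), hτm,
    fun t => dist_le_of_cellIndex_eq (hτ t), ⟨?_, ?_⟩, ?_⟩
  · rw [map_compProd_fst]
    congr 1
    ext1 t
    rw [Kernel.map_apply _ measurable_fst]
    exact (hγ _).1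
  · rw [map_compProd_snd, ← Measure.compProd_const]
    congr 1
    ext1 t
    rw [Kernel.map_apply _ measurable_snd]
    exact (hγ _).2
  · rw [Measure.lintegral_compProd (f := fun p => sqCost p.2)
      (measurable_sqCost.comp measurable_snd)]
    calc _ ≤ ∫⁻ t, (transportCost (m (τ (cellIndex k t)) : Measure (En n)) ν +
            ((k : ENNReal) + 1)⁻¹) := lintegral_mono fun t => hcost (cellIndex k t)
      _ ≤ _ := by
          rw [lintegral_add_right _ measurable_const]
          gcongr
          simp

theorem exists_subseq_tendsto_of_isPlan {κ : ℕ → Kernel unitInterval (En n)}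
    [∀ k, IsMarkovKernel (κ k)] {P : ℕ → ProbabilityMeasure (unitInterval × En n × En n)}
    {ν : ℕ → Measure (En n)} [∀ k, IsProbabilityMeasure (ν k)]
    (hP : ∀ k, IsPlan (κ k) (P k) (ν k)) {R : ℝ}
    (hR : ∀ k t, κ k t (Metric.closedBall 0 R)ᶜ = 0)
    (htight : ∀ ε : ENNReal, 0 < ε → ∃ K, IsCompact K ∧ ∀ k, ν k Kᶜ ≤ ε) :
    ∃ (Q : ProbabilityMeasure (unitInterval × En n × En n)) (φ : ℕ → ℕ), StrictMono φ ∧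
      Filter.Tendsto (P ∘ φ) Filter.atTop (𝓝 Q) := by
  refine ProbabilityMeasure.exists_subseq_tendsto_of_tight fun ε hε => ?_
  obtain ⟨K, hK, hKε⟩ := htight ε hε
  exact ⟨univ ×ˢ (Metric.closedBall 0 R ×ˢ K),
    isCompact_univ.prod ((isCompact_closedBall 0 R).prod hK), fun k =>
    ((hP k).measure_compl_le measurableSet_closedBall hK.measurableSet (hR k)).trans (hKε k)⟩

theorem exists_isPlan_lintegral_le {m : unitInterval → ProbabilityMeasure (En n)}
    (hm : Continuous m) {R : ℝ}
    (hR : ∀ t, (m t : Measure (En n)) (Metric.closedBall 0 R)ᶜ = 0) (ν : Measure (En n))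
    [IsProbabilityMeasure ν] :
    ∃ P, IsPlan (curveKernel m hm) P ν ∧
      ∫⁻ p, sqCost p.2 ∂P ≤ ∫⁻ t, transportCost (m t : Measure (En n)) ν := by
  choose P s hs hst hP hcost using fun k => exists_approx_plan hm hR ν k
  have hprob : ∀ k, IsProbabilityMeasure (P k) := fun k => (hP k).isProbabilityMeasure
  obtain ⟨Q, φ, hφ, hQ⟩ := exists_subseq_tendsto_of_isPlan (P := fun k => bundleProbability (P k))
    (ν := fun _ => ν) hP (fun k t => hR (s k t)) fun ε hε => by
      obtain ⟨K, hK, hKε⟩ := exists_isCompact_measure_compl_le ν hε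
      exact ⟨K, hK, fun _ => hKε⟩
  refine ⟨Q, ⟨?_, ?_⟩, ?_⟩
  · have hs0 : ∀ t, Filter.Tendsto (fun k => s k t) Filter.atTop (𝓝 t) := fun t =>
      tendsto_iff_dist_tendsto_zero.2 <| squeeze_zero (fun _ => dist_nonneg)
        (fun k => hst k t) tendsto_one_div_add_atTop_nhds_zero_nat
    exact map_eq_of_tendsto hQ (by fun_prop)
      ((tendsto_compProd_curveKernel_comap hm hs hs0).comp hφ.tendsto_atTop)
      fun k => (hP (φ k)).curve
  · exact map_eq_of_tendsto hQ (by fun_prop)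
      (tendsto_const_nhds (x := bundleProbability ((volume : Measure unitInterval).prod ν)))
      fun k => (hP (φ k)).marg
  · exact ProbabilityMeasure.lintegral_le_of_tendsto hQ (c := fun p => ‖p.2.1 - p.2.2‖ ^ 2)
      (by fun_prop) (fun p => by positivity)
      (tendsto_inv_add_one_nhds_zero.comp hφ.tendsto_atTop) fun k => hcost (φ k)

end PlanExistence

section Averaging

variable {n : ℕ}

theorem lintegral_sq_norm_sub_eq {Ω E : Type*} [MeasurableSpace Ω] [NormedAddCommGroup E]
    [InnerProductSpace ℝ E] [CompleteSpace E] [MeasurableSpace E] [BorelSpace E]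
    [SecondCountableTopology E] {ρ : Measure Ω} [IsProbabilityMeasure ρ] {Y : Ω → E}
    (hY : Measurable Y) {R : ℝ} (hR : ∀ᵐ ω ∂ρ, ‖Y ω‖ ≤ R) (x : E) :
    ∫⁻ ω, ENNReal.ofReal (‖Y ω - x‖ ^ 2) ∂ρ =
      ∫⁻ ω, ENNReal.ofReal (‖Y ω - ∫ ω, Y ω ∂ρ‖ ^ 2) ∂ρ +
        ENNReal.ofReal (‖x - ∫ ω, Y ω ∂ρ‖ ^ 2) := by
  set b := ∫ ω, Y ω ∂ρ with hb
  have hYi : Integrable Y ρ :=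
    Integrable.of_bound hY.aestronglyMeasurable R hR
  have hsq : ∀ z, Integrable (fun ω => ‖Y ω - z‖ ^ 2) ρ := fun z => by
    refine Integrable.of_bound (by fun_prop) ((R + ‖z‖) ^ 2) ?_
    filter_upwards [hR] with ω hω
    rw [Real.norm_of_nonneg (by positivity)]
    gcongr
    exact (norm_sub_le _ _).trans (by gcongr)
  rw [← ofReal_integral_eq_lintegral_ofReal (hsq x) (Filter.Eventually.of_forall fun _ => by
      positivity), ← ofReal_integral_eq_lintegral_ofReal (hsq b)
      (Filter.Eventually.of_forall fun _ => by positivity),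
    ← ENNReal.ofReal_add (integral_nonneg fun _ => by positivity) (by positivity)]
  congr 1
  have hYb : Integrable (fun ω => Y ω - b) ρ := hYi.sub (integrable_const b)
  have hinner : Integrable (fun ω => inner ℝ (b - x) (Y ω - b)) ρ :=
    hYb.const_inner (b - x)
  have h0 : ∫ ω, inner ℝ (b - x) (Y ω - b) ∂ρ = 0 := by
    rw [integral_inner hYb, integral_sub hYi (integrable_const b)]
    simp [hb]
  have hexp : ∀ ω, ‖Y ω - x‖ ^ 2 =
      ‖Y ω - b‖ ^ 2 + 2 * inner ℝ (b - x) (Y ω - b) + ‖x - b‖ ^ 2 := fun ω => by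
    rw [show Y ω - x = (Y ω - b) + (b - x) by abel, norm_add_sq_real, norm_sub_rev x b,
      real_inner_comm]
  simp_rw [hexp]
  have hsum : Integrable (fun ω => ‖Y ω - b‖ ^ 2 + 2 * inner ℝ (b - x) (Y ω - b)) ρ :=
    (hsq b).add (hinner.const_mul 2)
  rw [integral_add hsum (integrable_const _),
    integral_add (hsq b) (hinner.const_mul 2), integral_const_mul, h0]
  simp

theorem measurable_integral_fst {T : unitInterval × En n → En n} (hT : Measurable T) :
    Measurable fun x => ∫ t, T (t, x) := by
  have h : StronglyMeasurable fun p : En n × unitInterval => T (p.2, p.1) :=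
    (hT.comp (by fun_prop)).stronglyMeasurable
  exact h.integral_prod_right.measurable

/-- Disintegration of a plan over the time and the second space variable. -/
theorem IsPlan.exists_kernel {κ : Kernel unitInterval (En n)} [IsMarkovKernel κ]
    {P : Measure (unitInterval × En n × En n)} {ν : Measure (En n)} [IsProbabilityMeasure ν]
    (h : IsPlan κ P ν) :
    ∃ η : Kernel (unitInterval × En n) (En n), IsMarkovKernel η ∧
      P.map (fun p => ((p.1, p.2.2), p.2.1)) = ((volume : Measure unitInterval).prod ν) ⊗ₘ η ∧
      ∀ᵐ t : unitInterval, (ν ⊗ₘ η.sectR t).map Prod.snd = κ t := by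
  have := h.isProbabilityMeasure
  set P' := P.map (fun p => ((p.1, p.2.2), p.2.1)) with hP'
  have : IsProbabilityMeasure P' := Measure.isProbabilityMeasure_map (by fun_prop)
  have hfst : P'.fst = (volume : Measure unitInterval).prod ν := by
    rw [← h.marg, Measure.fst, hP', Measure.map_map measurable_fst (by fun_prop)]
    rfl
  have hdis : ((volume : Measure unitInterval).prod ν) ⊗ₘ P'.condKernel = P' := by
    rw [← hfst, P'.disintegrate P'.condKernel]
  refine ⟨P'.condKernel, inferInstance, hdis.symm, ?_⟩
  have hker : (Kernel.const unitInterval ν ⊗ₖ P'.condKernel).map Prod.snd =ᵐ[volume] κ := by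
    refine Kernel.ae_eq_of_compProd_eq ?_
    rw [← map_compProd_snd, ← Measure.compProd_assoc', Measure.compProd_const, hdis,
      ← h.curve, hP', Measure.map_map (by fun_prop) (by fun_prop),
      Measure.map_map (by fun_prop) (by fun_prop)]
    rfl
  filter_upwards [hker] with t ht
  rw [← ht, Kernel.map_apply _ measurable_snd, Kernel.compProd_apply_eq_compProd_sectR,
    Kernel.const_apply]

theorem IsPlan.exists_average {κ : Kernel unitInterval (En n)} [IsMarkovKernel κ]
    {P : Measure (unitInterval × En n × En n)} {ν : Measure (En n)} [IsProbabilityMeasure ν]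
    (h : IsPlan κ P ν) {C : Set (En n)} (hC : Convex ℝ C) {R : ℝ}
    (hCR : C ⊆ Metric.closedBall 0 R) (hκ : ∀ t, κ t Cᶜ = 0) :
    ∃ T : unitInterval × En n → En n, Measurable T ∧
      (∀ᵐ t, ∀ᵐ x ∂ν, T (t, x) ∈ C) ∧ (∀ᵐ x ∂ν, ∀ᵐ t, ‖T (t, x)‖ ≤ R) ∧
      IsPlan κ (P.map fun p => (p.1, p.2.1, ∫ t, T (t, p.2.2)))
        (ν.map fun x => ∫ t, T (t, x)) ∧
      ∫⁻ p, sqCost p.2 ∂(P.map fun p => (p.1, p.2.1, ∫ t, T (t, p.2.2))) +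
        ∫⁻ x, ENNReal.ofReal (‖x - ∫ t, T (t, x)‖ ^ 2) ∂ν ≤ ∫⁻ p, sqCost p.2 ∂P := by
  obtain ⟨η, hη, hPη, hηκ⟩ := h.exists_kernel
  have hTm : StronglyMeasurable fun q => ∫ y, y ∂(η q) :=
    StronglyMeasurable.integral_kernel (f := fun y => y) stronglyMeasurable_id
  set T : unitInterval × En n → En n := fun q => ∫ y, y ∂(η q) with hT
  set b : En n → En n := fun x => ∫ t, T (t, x) with hb
  have hbm : Measurable b := measurable_integral_fst hTm.measurable
  have hcm : Measurable fun p : unitInterval × En n × En n => (p.1, p.2.1, b p.2.2) := by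
    fun_prop
  have hdm : Measurable fun x => ENNReal.ofReal (‖x - b x‖ ^ 2) := by fun_prop
  have hmem : ∀ᵐ t, ∀ᵐ x ∂ν, ∀ᵐ y ∂(η (t, x)), y ∈ C := by
    filter_upwards [hηκ] with t ht
    have h1 : ∀ᵐ p ∂(ν ⊗ₘ η.sectR t), p.2 ∉ toMeasurable (κ t) Cᶜ := by
      have : ∀ᵐ y ∂((ν ⊗ₘ η.sectR t).map Prod.snd), y ∉ toMeasurable (κ t) Cᶜ := by
        rw [ht, ← measure_eq_zero_iff_ae_notMem, measure_toMeasurable, hκ]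
      exact ae_of_ae_map measurable_snd.aemeasurable this
    filter_upwards [Measure.ae_ae_of_ae_compProd h1] with x hx
    rw [Kernel.sectR_apply] at hx
    filter_upwards [hx] with y hy
    by_contra hyC
    exact hy (subset_toMeasurable _ _ hyC)
  have hball : ∀ᵐ x ∂ν, ∀ᵐ t, ∀ᵐ y ∂(η (t, x)), ‖y‖ ≤ R := by
    have hms : MeasurableSet {q : unitInterval × En n | η q (Metric.closedBall 0 R)ᶜ = 0} :=
      (η.measurable_coe measurableSet_closedBall.compl) (measurableSet_singleton 0)
    have h1 : ∀ᵐ t, ∀ᵐ x ∂ν, η (t, x) (Metric.closedBall 0 R)ᶜ = 0 := by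
      filter_upwards [hmem] with t ht
      filter_upwards [ht] with x hx
      exact measure_mono_null (compl_subset_compl.2 hCR) hx
    have h2 := (Measure.ae_ae_comm hms).1 h1
    filter_upwards [h2] with x hx
    filter_upwards [hx] with t ht
    filter_upwards [measure_eq_zero_iff_ae_notMem.1 ht] with y hy
    simpa using hy
  have hbound : ∀ {q}, (∀ᵐ y ∂(η q), ‖y‖ ≤ R) → ‖T q‖ ≤ R := fun {q} hq => by
    simpa using norm_integral_le_of_norm_le_const hq
  refine ⟨T, hTm.measurable, ?_, ?_, ⟨?_, ?_⟩, ?_⟩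
  · filter_upwards [hmem] with t ht
    filter_upwards [ht] with x hx
    refine Convex.integral_mem_of_finiteDimensional hC measurable_id
      (Integrable.of_bound aestronglyMeasurable_id R ?_) hx
    filter_upwards [hx] with y hy
    simpa using hCR hy
  · filter_upwards [hball] with x hx
    filter_upwards [hx] with t ht using hbound ht
  · rw [Measure.map_map (by fun_prop) hcm, ← h.curve]
    rfl
  · rw [Measure.map_map (by fun_prop) hcm]
    have h1 := Measure.map_prod_map (volume : Measure unitInterval) ν measurable_id hbm
    rw [Measure.map_id, ← h.marg, Measure.map_map (by fun_prop) (by fun_prop)] at h1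
    exact h1.symm
  · have hdis : ∀ F : En n × En n → ENNReal, Measurable F → ∫⁻ p, F p.2 ∂P =
        ∫⁻ x, ∫⁻ p, F (p.2, x) ∂((volume : Measure unitInterval) ⊗ₘ η.sectL x) ∂ν := by
      intro F hF
      have h1 : ∫⁻ p, F p.2 ∂P =
          ∫⁻ q, F (q.2, q.1.2) ∂(P.map (fun p => ((p.1, p.2.2), p.2.1))) := by
        rw [lintegral_map (by fun_prop) (by fun_prop)]
      rw [h1, hPη, Measure.lintegral_compProd (by fun_prop), lintegral_prod_symm']
      · refine lintegral_congr fun x => ?_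
        rw [Measure.lintegral_compProd (by fun_prop)]
        rfl
      · exact Measurable.lintegral_kernel_prod_right (f := fun (q : unitInterval × En n) y => F (y, q.2)) (by fun_prop)
    rw [lintegral_map (f := fun p : unitInterval × En n × En n => sqCost p.2)
        (measurable_sqCost.comp measurable_snd) hcm,
      hdis sqCost measurable_sqCost,
      hdis (fun p => sqCost (p.1, b p.2)) (measurable_sqCost.comp (by fun_prop)),
      ← lintegral_add_right _ hdm]
    refine lintegral_mono_ae ?_
    filter_upwards [hball] with x hx
    have hYR : ∀ᵐ p ∂((volume : Measure unitInterval) ⊗ₘ η.sectL x), ‖p.2‖ ≤ R := by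
      refine (Measure.ae_compProd_iff (measurableSet_le (by fun_prop) (by fun_prop))).2 ?_
      exact hx
    have hbx : ∫ p, p.2 ∂((volume : Measure unitInterval) ⊗ₘ η.sectL x) = b x := by
      rw [Measure.integral_compProd
        (Integrable.of_bound measurable_snd.aestronglyMeasurable R hYR)]
      rfl
    have := lintegral_sq_norm_sub_eq measurable_snd hYR x
    rw [hbx] at this
    exact this.ge

end Averaging

section Barycenter

variable {n : ℕ}

theorem ae_norm_le_of_measure_compl_closedBall {ν : Measure (En n)} {R : ℝ}
    (hν : ν (Metric.closedBall 0 R)ᶜ = 0) : ∀ᵐ x ∂ν, ‖x‖ ≤ R := by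
  filter_upwards [measure_eq_zero_iff_ae_notMem.1 hν] with x hx
  simpa using hx

theorem finSecMom_of_measure_compl_closedBall {ν : Measure (En n)} [IsProbabilityMeasure ν]
    {R : ℝ} (hν : ν (Metric.closedBall 0 R)ᶜ = 0) : FinSecMom ν := by
  refine Integrable.of_bound (by fun_prop) (R ^ 2) ?_
  filter_upwards [ae_norm_le_of_measure_compl_closedBall hν] with x hx
  rw [Real.norm_of_nonneg (by positivity)]
  gcongr

theorem integral_sq_norm_le {ν : Measure (En n)} [IsProbabilityMeasure ν]
    {R : ℝ} (hν : ν (Metric.closedBall 0 R)ᶜ = 0) : ∫ x, ‖x‖ ^ 2 ∂ν ≤ R ^ 2 := by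
  calc _ ≤ ∫ _, R ^ 2 ∂ν := by
        refine integral_mono_ae (finSecMom_of_measure_compl_closedBall hν) (integrable_const _) ?_
        filter_upwards [ae_norm_le_of_measure_compl_closedBall hν] with x hx
        gcongr
    _ = _ := by simp

theorem map_integral_compl_closedBall {ν : Measure (En n)} {R : ℝ}
    {T : unitInterval × En n → En n} (hT : Measurable T)
    (hTR : ∀ᵐ x ∂ν, ∀ᵐ t, ‖T (t, x)‖ ≤ R) :
    (ν.map fun x => ∫ t, T (t, x)) (Metric.closedBall 0 R)ᶜ = 0 := by
  have hbm := measurable_integral_fst hT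
  rw [Measure.map_apply hbm measurableSet_closedBall.compl, measure_eq_zero_iff_ae_notMem]
  filter_upwards [hTR] with x hx
  simpa using norm_integral_le_of_norm_le_const hx

theorem isProbabilityMeasure_map_integral {ν : Measure (En n)} [IsProbabilityMeasure ν]
    {T : unitInterval × En n → En n} (hT : Measurable T) :
    IsProbabilityMeasure (ν.map fun x => ∫ t, T (t, x)) :=
  Measure.isProbabilityMeasure_map (measurable_integral_fst hT).aemeasurable

theorem exists_minimizer {m : unitInterval → ProbabilityMeasure (En n)} (hm : Continuous m)
    {R : ℝ} (hR : ∀ t, (m t : Measure (En n)) (Metric.closedBall 0 R)ᶜ = 0) :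
    ∃ ν : Measure (En n), IsProbabilityMeasure ν ∧ FinSecMom ν ∧
      ∀ ν' : Measure (En n), IsProbabilityMeasure ν' →
        ∫⁻ t, transportCost (m t : Measure (En n)) ν ≤
          ∫⁻ t, transportCost (m t : Measure (En n)) ν' := by
  set a := ⨅ ν : ProbabilityMeasure (En n),
    ∫⁻ t, transportCost (m t : Measure (En n)) (ν : Measure (En n)) with ha
  have hstep : ∀ k : ℕ, ∃ (P : ProbabilityMeasure (unitInterval × En n × En n))
      (ν : ProbabilityMeasure (En n)), IsPlan (curveKernel m hm) P ν ∧
      (ν : Measure (En n)) (Metric.closedBall 0 R)ᶜ = 0 ∧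
      ∫⁻ p, sqCost p.2 ∂(P : Measure (unitInterval × En n × En n)) ≤
        a + ((k : ENNReal) + 1)⁻¹ := by
    intro k
    obtain ⟨ν, hν⟩ : ∃ ν : ProbabilityMeasure (En n),
        ∫⁻ t, transportCost (m t : Measure (En n)) (ν : Measure (En n)) ≤
          a + ((k : ENNReal) + 1)⁻¹ := by
      by_cases htop : a = ⊤
      · exact ⟨m 0, by simp [htop]⟩
      · obtain ⟨ν, hν⟩ := iInf_lt_iff.1 (ENNReal.lt_add_right htop
          (show ((k : ENNReal) + 1)⁻¹ ≠ 0 by simp))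
        exact ⟨ν, hν.le⟩
    obtain ⟨P, hP, hPc⟩ := exists_isPlan_lintegral_le hm hR (ν : Measure (En n))
    obtain ⟨T, hT, -, hTR, hP', hcost⟩ := hP.exists_average (convex_closedBall 0 R)
      subset_rfl hR
    have := isProbabilityMeasure_map_integral (ν := (ν : Measure (En n))) hT
    have := hP'.isProbabilityMeasure
    exact ⟨bundleProbability _, bundleProbability _, hP', map_integral_compl_closedBall hT hTR,
      le_self_add.trans (hcost.trans (hPc.trans hν))⟩
  choose P ν hP hνR hcost using hstep
  obtain ⟨Q, φ, hφ, hQ⟩ := exists_subseq_tendsto_of_isPlan (ν := fun k => (ν k : Measure (En n)))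
    hP (fun _ => hR) fun ε _ => ⟨Metric.closedBall 0 R, isCompact_closedBall 0 R, fun k => by
      rw [hνR k]; exact zero_le⟩
  have hc : Continuous fun p : unitInterval × En n × En n => p.2.2 := by fun_prop
  set N : ProbabilityMeasure (En n) := Q.map hc.measurable.aemeasurable with hN
  have hνN : Filter.Tendsto (fun k => ν (φ k)) Filter.atTop (𝓝 N) := by
    have h1 := ProbabilityMeasure.tendsto_map_of_tendsto_of_continuous _ _ hQ hc
    refine h1.congr fun k => ?_
    refine Subtype.ext ?_
    have h2 := congrArg Measure.snd (hP (φ k)).marg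
    rw [Measure.snd_prod, Measure.snd, Measure.map_map measurable_snd (by fun_prop)] at h2
    exact h2
  have hNR : (N : Measure (En n)) (Metric.closedBall 0 R)ᶜ = 0 := by
    have h1 := ProbabilityMeasure.le_liminf_measure_open_of_tendsto hνN
      (Metric.isClosed_closedBall (x := (0 : En n)) (ε := R)).isOpen_compl
    simpa [hνR] using h1
  have hQplan : IsPlan (curveKernel m hm) Q N := by
    refine ⟨?_, ?_⟩
    · exact map_eq_of_tendsto hQ (by fun_prop)
        (tendsto_const_nhds (x := bundleProbability (volume ⊗ₘ curveKernel m hm)))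
        fun k => (hP (φ k)).curve
    · have h1 : Filter.Tendsto
          (fun k => (bundleProbability (volume : Measure unitInterval)).prod (ν (φ k)))
          Filter.atTop (𝓝 ((bundleProbability (volume : Measure unitInterval)).prod N)) :=
        (ProbabilityMeasure.continuous_prod.tendsto _).comp (tendsto_const_nhds.prodMk_nhds hνN)
      exact map_eq_of_tendsto hQ (by fun_prop) h1 fun k => (hP (φ k)).marg
  refine ⟨N, inferInstance, finSecMom_of_measure_compl_closedBall hNR, fun ν' hν' => ?_⟩
  calc _ ≤ ∫⁻ p, sqCost p.2 ∂(Q : Measure (unitInterval × En n × En n)) :=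
        hQplan.lintegral_transportCost_le
    _ ≤ a := ProbabilityMeasure.lintegral_le_of_tendsto hQ (c := fun p => ‖p.2.1 - p.2.2‖ ^ 2)
        (by fun_prop) (fun p => by positivity)
        (tendsto_inv_add_one_nhds_zero.comp hφ.tendsto_atTop) fun k => hcost (φ k)
    _ ≤ _ := iInf_le (fun ν : ProbabilityMeasure (En n) =>
        ∫⁻ t, transportCost (m t : Measure (En n)) (ν : Measure (En n))) ⟨ν', hν'⟩

theorem measure_compl_eq_zero_of_minimizer {m : unitInterval → ProbabilityMeasure (En n)}
    (hm : Continuous m) {C : Set (En n)} (hC : Convex ℝ C) {R : ℝ}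
    (hCR : C ⊆ Metric.closedBall 0 R) (hmC : ∀ t, (m t : Measure (En n)) Cᶜ = 0)
    {ν : Measure (En n)} [IsProbabilityMeasure ν]
    (hfin : ∫⁻ t, transportCost (m t : Measure (En n)) ν ≠ ⊤)
    (hmin : ∀ ν' : Measure (En n), IsProbabilityMeasure ν' →
      ν' (Metric.closedBall 0 R)ᶜ = 0 → ∫⁻ t, transportCost (m t : Measure (En n)) ν ≤
        ∫⁻ t, transportCost (m t : Measure (En n)) ν') :
    ν Cᶜ = 0 := by
  have hR : ∀ t, (m t : Measure (En n)) (Metric.closedBall 0 R)ᶜ = 0 := fun t =>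
    measure_mono_null (compl_subset_compl.2 hCR) (hmC t)
  obtain ⟨P, hP, hPc⟩ := exists_isPlan_lintegral_le hm hR ν
  obtain ⟨T, hT, hTC, hTR, hP', hcost⟩ := hP.exists_average hC hCR hmC
  have := isProbabilityMeasure_map_integral (ν := ν) hT
  have hmin' := (hmin _ this (map_integral_compl_closedBall hT hTR)).trans
    hP'.lintegral_transportCost_le
  have hle := (hcost.trans hPc).trans hmin'
  have hne := ((le_self_add.trans (hcost.trans hPc)).trans_lt hfin.lt_top).ne
  have hzero : ∫⁻ x, ENNReal.ofReal (‖x - ∫ t, T (t, x)‖ ^ 2) ∂ν = 0 := by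
    have h1 := ENNReal.le_of_add_le_add_left hne (hle.trans (add_zero _).ge)
    simpa using h1
  have hbm := measurable_integral_fst hT
  have hfix : ∀ᵐ x ∂ν, ∫ t, T (t, x) = x := by
    have hdm : Measurable fun x => ENNReal.ofReal (‖x - ∫ t, T (t, x)‖ ^ 2) :=
      ((measurable_id.sub hbm).norm.pow_const 2).ennreal_ofReal
    rw [lintegral_eq_zero_iff hdm] at hzero
    filter_upwards [hzero] with x hx
    have h1 : ‖x - ∫ t, T (t, x)‖ ^ 2 ≤ 0 := ENNReal.ofReal_eq_zero.1 hx
    have h2 : ‖x - ∫ t, T (t, x)‖ = 0 := by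
      nlinarith [norm_nonneg (x - ∫ t, T (t, x)), sq_nonneg ‖x - ∫ t, T (t, x)‖]
    exact (sub_eq_zero.1 (norm_eq_zero.1 h2)).symm
  have hsample := ae_integral_mem_convexHull_range (volume : Measure unitInterval) ν hT <| by
    filter_upwards [hTR] with x hx
    exact Integrable.of_bound (hT.comp (by fun_prop)).aestronglyMeasurable R hx
  have hTC' : ∀ᵐ ω ∂(Measure.infinitePi fun _ : ℕ => (volume : Measure unitInterval)),
      ∀ k, ∀ᵐ x ∂ν, T (ω k, x) ∈ C := ae_all_iff.2 fun k =>
    (measurePreserving_eval_infinitePi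
      (fun _ : ℕ => (volume : Measure unitInterval)) k).quasiMeasurePreserving.ae hTC
  obtain ⟨ω, hω, hωC⟩ := (hsample.and hTC').exists
  rw [measure_eq_zero_iff_ae_notMem]
  filter_upwards [hfix, hω, ae_all_iff.2 hωC] with x hx hxω hxC
  rw [hx] at hxω
  have := convexHull_min (range_subset_iff.2 hxC) hC hxω
  simpa using this

end Barycenter

section Conversion

variable {n : ℕ}

theorem transportCost_le_of_measure_compl_closedBall {μ ν : Measure (En n)}
    [IsProbabilityMeasure μ] [IsProbabilityMeasure ν] {R : ℝ}
    (hμ : μ (Metric.closedBall 0 R)ᶜ = 0) (hν : FinSecMom ν) :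
    transportCost μ ν ≤ ENNReal.ofReal (2 * R ^ 2 + 2 * ∫ x, ‖x‖ ^ 2 ∂ν) := by
  refine (transportCost_le (finSecMom_of_measure_compl_closedBall hμ) hν).trans ?_
  have := integral_sq_norm_le hμ
  gcongr

theorem lintegral_transportCost_ne_top {m : unitInterval → ProbabilityMeasure (En n)}
    {R : ℝ} (hR : ∀ t, (m t : Measure (En n)) (Metric.closedBall 0 R)ᶜ = 0)
    {ν : Measure (En n)} [IsProbabilityMeasure ν] (hν : FinSecMom ν) :
    ∫⁻ t, transportCost (m t : Measure (En n)) ν ≠ ⊤ := by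
  refine ne_top_of_le_ne_top (ENNReal.ofReal_ne_top
    (r := 2 * R ^ 2 + 2 * ∫ x, ‖x‖ ^ 2 ∂ν)) ?_
  calc _ ≤ ∫⁻ _ : unitInterval, ENNReal.ofReal (2 * R ^ 2 + 2 * ∫ x, ‖x‖ ^ 2 ∂ν) :=
        lintegral_mono fun t => transportCost_le_of_measure_compl_closedBall (hR t) hν
    _ = _ := by simp

theorem integral_W2sq {m : unitInterval → ProbabilityMeasure (En n)} (hm : Continuous m)
    {R : ℝ} (hR : ∀ t, (m t : Measure (En n)) (Metric.closedBall 0 R)ᶜ = 0)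
    {μ : ℝ → Measure (En n)} (hμ : ∀ t : unitInterval, μ t = m t)
    {ν : Measure (En n)} [IsProbabilityMeasure ν] (hν : FinSecMom ν) :
    ∫ t in Icc (0 : ℝ) 1, W2sq (μ t) ν =
      (∫⁻ t, transportCost (m t : Measure (En n)) ν).toReal := by
  have h1 : ∫ t in Icc (0 : ℝ) 1, W2sq (μ t) ν = ∫ t : unitInterval, W2sq (μ t) ν :=
    (integral_subtype_comap measurableSet_Icc fun t => W2sq (μ t) ν).symm
  have h2 : ∀ t : unitInterval, W2sq (μ t) ν = (transportCost (m t : Measure (En n)) ν).toReal :=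
    fun t => by
      rw [← ofReal_W2sq (finSecMom_of_measure_compl_closedBall (hR t)) hν,
        ENNReal.toReal_ofReal (W2sq_nonneg _ _), hμ]
  rw [h1]
  simp_rw [h2]
  exact integral_toReal (lowerSemicontinuous_transportCost hm hR ν).measurable.aemeasurable
    (Filter.Eventually.of_forall fun t =>
      (transportCost_le_of_measure_compl_closedBall (hR t) hν).trans_lt ENNReal.ofReal_lt_top)

end Conversion

/-- a barycenter of a weakly continuous curve of measures on a bounded domain
exists, and every barycenter is supported on the convex hull of `M`. -/
theorem stmt4 {n : ℕ} (M : Set (En n)) (hM : Bornology.IsBounded M)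
    (μ : ℝ → Measure (En n)) (hprob : ∀ t ∈ Icc (0:ℝ) 1, IsProbabilityMeasure (μ t))
    (hsupp : ∀ t ∈ Icc (0:ℝ) 1, μ t Mᶜ = 0)
    (hcont : WeakContOn μ (Icc 0 1)) :
    (∃ μb : Measure (En n), IsBarycenter μ μb) ∧
      ∀ μb : Measure (En n), IsBarycenter μ μb → μb (convexHull ℝ M)ᶜ = 0 := by
  obtain ⟨R, hMR⟩ := hM.subset_closedBall 0
  let m : unitInterval → ProbabilityMeasure (En n) := fun t => ⟨μ t, hprob t t.2⟩
  have hm : Continuous m := by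
    rw [continuous_iff_continuousAt]
    intro t
    refine ProbabilityMeasure.tendsto_iff_forall_integral_tendsto.2 fun f => ?_
    exact (continuousOn_iff_continuous_domRestrict.1 (hcont f)).tendsto t
  have hμ : ∀ t : unitInterval, μ t = m t := fun _ => rfl
  have hmM : ∀ t, (m t : Measure (En n)) (convexHull ℝ M)ᶜ = 0 := fun t =>
    measure_mono_null (compl_subset_compl.2 (subset_convexHull ℝ M)) (hsupp t t.2)
  have hCR : convexHull ℝ M ⊆ Metric.closedBall 0 R :=
    convexHull_min hMR (convex_closedBall 0 R)
  have hR : ∀ t, (m t : Measure (En n)) (Metric.closedBall 0 R)ᶜ = 0 := fun t =>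
    measure_mono_null (compl_subset_compl.2 hCR) (hmM t)
  constructor
  · obtain ⟨ν, hν, hνm, hmin⟩ := exists_minimizer hm hR
    refine ⟨ν, hν, hνm, fun ν' hν' hνm' => ?_⟩
    rw [integral_W2sq hm hR hμ hνm, integral_W2sq hm hR hμ hνm']
    exact ENNReal.toReal_mono (lintegral_transportCost_ne_top hR hνm') (hmin ν' hν')
  · rintro ν ⟨hν, hνm, hmin⟩
    refine measure_compl_eq_zero_of_minimizer hm (convex_convexHull ℝ M) hCR hmM
      (lintegral_transportCost_ne_top hR hνm) fun ν' hν' hνR' => ?_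
    have hνm' := finSecMom_of_measure_compl_closedBall hνR'
    have h := hmin ν' hν' hνm'
    rw [integral_W2sq hm hR hμ hνm, integral_W2sq hm hR hμ hνm'] at h
    exact (ENNReal.toReal_le_toReal (lintegral_transportCost_ne_top hR hνm)
      (lintegral_transportCost_ne_top hR hνm')).1 h
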